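/- Let I = (−1,1), let φ be the Euclidean norm on ℝ², let a ∈ (0,1), set b := √(2a − a²), and define g(s) = a for s ∈ (0,1) and g(s) = −a for s ∈ (−1,0). Define u : I → ℝ by u(s) = a for s ∈ [b,1); u(s) = a − 1 + √(1 − (s − b)²) for s ∈ [0,b]; u(s) = 1 − a − √(1 − (s + b)²) for s ∈ [−b,0]; u(s) = −a for s ∈ (−1,−b]. Then u ∈ C^{1,1}(I) but u ∉ C²(I), and u is the unique minimizer over BV(−1,1) of the functional G(v) = 𝒜_{|·|}(v,I) + ∫_I |v − g| ds. -/

import Mathlib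

open MeasureTheory Set Filter Topology Bornology
open scoped ENNReal NNReal RealInnerProductSpace symmDiff

noncomputable section

abbrev E2 : Type := EuclideanSpace ℝ (Fin 2)

def vec2 (a b : ℝ) : E2 := (WithLp.equiv 2 (Fin 2 → ℝ)).symm ![a, b]

def e1 : E2 := vec2 1 0
def e2 : E2 := vec2 0 1

/-- `φ` is an anisotropy (a norm) on `ℝ²`. -/
structure IsAnisotropy (φ : E2 → ℝ) : Prop where
  nonneg : ∀ x, 0 ≤ φ x
  eq_zero_iff : ∀ x, φ x = 0 ↔ x = 0
  smul_eq : ∀ (c : ℝ) (x : E2), φ (c • x) = |c| * φ x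
  add_le : ∀ x y, φ (x + y) ≤ φ x + φ y
  bounds : ∃ c ∈ Set.Ioc (0:ℝ) 1, ∀ x : E2, ‖x‖ = 1 → c ≤ φ x ∧ φ x ≤ 1 / c

/-- The dual anisotropy `φ°(ξ) = max {⟪ξ,η⟫ : φ(η) = 1}`. -/
def dualA (φ : E2 → ℝ) (ξ : E2) : ℝ := sSup {r : ℝ | ∃ η : E2, φ η = 1 ∧ r = ⟪ξ, η⟫}

/-- The Wulff shape `W^φ = {φ ≤ 1}`. -/
def wulff (φ : E2 → ℝ) : Set E2 := {x | φ x ≤ 1}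

/-- The Wulff shape of radius `r` centered at `x`. -/
def wulffBall (φ : E2 → ℝ) (r : ℝ) (x : E2) : Set E2 := {y | φ (y - x) ≤ r}

/-- `φ` is partially monotone, i.e. even in each coordinate separately. -/
def PartiallyMonotone (φ : E2 → ℝ) : Prop := ∀ x : E2, φ x = φ (vec2 |x 0| |x 1|)

/-- The Wulff shape of `φ` is symmetric with respect to both coordinate axes. -/
def AxisSymmetric (φ : E2 → ℝ) : Prop :=
  ∀ x : E2, φ (vec2 (-(x 0)) (x 1)) = φ x ∧ φ (vec2 (x 0) (-(x 1))) = φ x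

/-- `W^φ` has no vertical facets: `±e₁` is an outer normal to `W^φ` only at `±e₁/φ(e₁)`. -/
def NoVerticalFacets (φ : E2 → ℝ) : Prop :=
  (∀ η ∈ wulff φ, (∀ y ∈ wulff φ, ⟪e1, y - η⟫ ≤ 0) → η = (φ e1)⁻¹ • e1) ∧
  (∀ η ∈ wulff φ, (∀ y ∈ wulff φ, ⟪-e1, y - η⟫ ≤ 0) → η = -((φ e1)⁻¹ • e1))

/-- `φ` is elliptic: `φ - λ|·|` is again a norm for some `λ > 0`. -/
def IsElliptic (φ : E2 → ℝ) : Prop :=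
  ∃ lam > (0:ℝ), IsAnisotropy (fun x => φ x - lam * ‖x‖)

/-- `φ` is a `C²`-anisotropy. -/
def IsC2Aniso (φ : E2 → ℝ) : Prop := ContDiffOn ℝ 2 φ {(0:E2)}ᶜ

/-- The anisotropic area `𝒜_φ(u,J)` (φ-total variation of `(-Du, L¹)`). -/
def aniArea (φ : E2 → ℝ) (u : ℝ → ℝ) (J : Set ℝ) : ℝ≥0∞ :=
  ⨆ (h₁ : ℝ → ℝ) (h₂ : ℝ → ℝ) (_ : ContDiff ℝ 1 h₁) (_ : ContDiff ℝ 1 h₂)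
    (_ : HasCompactSupport h₁) (_ : HasCompactSupport h₂)
    (_ : tsupport h₁ ⊆ J) (_ : tsupport h₂ ⊆ J)
    (_ : ∀ s ∈ J, φ (vec2 (h₁ s) (h₂ s)) ≤ 1),
    ENNReal.ofReal (∫ s in J, (u s * deriv h₁ s + h₂ s))

/-- The (Euclidean) total variation of `Du` on `J`. -/
def totalVar (u : ℝ → ℝ) (J : Set ℝ) : ℝ≥0∞ :=
  ⨆ (h : ℝ → ℝ) (_ : ContDiff ℝ 1 h) (_ : HasCompactSupport h) (_ : tsupport h ⊆ J)
    (_ : ∀ s ∈ J, |h s| ≤ 1), ENNReal.ofReal (∫ s in J, u s * deriv h s)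

/-- `u ∈ BV(I)`. -/
def BVOn (u : ℝ → ℝ) (I : Set ℝ) : Prop := IntegrableOn u I ∧ totalVar u I < ⊤

/-- `u ∈ BV_loc(I)`. -/
def BVLocOn (u : ℝ → ℝ) (I : Set ℝ) : Prop :=
  ∀ J : Set ℝ, IsOpen J → IsCompact (closure J) → closure J ⊆ I → BVOn u J

/-- The `L^∞`-norm of `u` on `I`. -/
def supNorm (u : ℝ → ℝ) (I : Set ℝ) : ℝ≥0∞ :=
  essSup (fun s => (‖u s‖₊ : ℝ≥0∞)) (volume.restrict I)

/-- The functional `G(u) = 𝒜_φ(u,I) + ∫_I |u-g|^p ds` (with value `+∞` when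
`u ∉ BV(I)` or `u - g ∉ L^p(I)`). -/
def Gfun (φ : E2 → ℝ) (p : ℝ) (g : ℝ → ℝ) (I : Set ℝ) (u : ℝ → ℝ) : ℝ≥0∞ :=
  aniArea φ u I + ∫⁻ s in I, ENNReal.ofReal (|u s - g s| ^ p)

/-- `u` minimizes `G` over `L¹(I)`. -/
def IsMinimizerG (φ : E2 → ℝ) (p : ℝ) (g : ℝ → ℝ) (I : Set ℝ) (u : ℝ → ℝ) : Prop :=
  IntegrableOn u I ∧ ∀ v : ℝ → ℝ, IntegrableOn v I → Gfun φ p g I u ≤ Gfun φ p g I v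

/-- `u` is a `Λ`-local minimizer of `𝒜_φ` in `I`. -/
def IsLambdaLocMin (φ : E2 → ℝ) (Λ : ℝ) (I : Set ℝ) (u : ℝ → ℝ) : Prop :=
  ∀ J : Set ℝ, IsOpen J → IsCompact (closure J) → closure J ⊆ I →
    ∀ ψ : ℝ → ℝ, ContDiff ℝ 1 ψ → HasCompactSupport ψ → tsupport ψ ⊆ J →
      aniArea φ u J ≤ aniArea φ (fun s => u s + ψ s) J + ENNReal.ofReal (Λ * ∫ s in J, |ψ s|)

/-- `ν` is the measure-theoretic outer unit normal of `E` at `x` (De Giorgi blow-up). -/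
def IsOuterNormalAt (E : Set E2) (x ν : E2) : Prop :=
  ‖ν‖ = 1 ∧ Tendsto
    (fun r : ℝ => volume (({y : E2 | x + r • y ∈ E} ∆ {y : E2 | ⟪y, ν⟫ ≤ 0}) ∩ Metric.ball (0:E2) 1))
    (𝓝[>] 0) (𝓝 0)

/-- The reduced boundary `∂*E`. -/
def redBoundary (E : Set E2) : Set E2 := {x | ∃ ν, IsOuterNormalAt E x ν}

open Classical in
/-- The generalized outer unit normal `ν_E`. -/
def genNormal (E : Set E2) (x : E2) : E2 :=
  if h : ∃ ν, IsOuterNormalAt E x ν then h.choose else 0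

/-- The anisotropic perimeter `P_φ(E,Ω) = ∫_{Ω ∩ ∂*E} φ°(ν_E) dH¹`. -/
def aniPer (φ : E2 → ℝ) (E : Set E2) (Ω : Set E2) : ℝ≥0∞ :=
  ∫⁻ x in Ω ∩ redBoundary E, ENNReal.ofReal (dualA φ (genNormal E x)) ∂μH[1]

/-- The divergence of a vector field on `ℝ²`. -/
def div2 (T : E2 → E2) (x : E2) : ℝ :=
  ∑ i : Fin 2, fderiv ℝ T x (EuclideanSpace.single i 1) i

/-- Distributional perimeter of `F` in an open set `Ω`. -/
def perVar (F : Set E2) (Ω : Set E2) : ℝ≥0∞ :=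
  ⨆ (T : E2 → E2) (_ : ContDiff ℝ 1 T) (_ : HasCompactSupport T) (_ : tsupport T ⊆ Ω)
    (_ : ∀ x, ‖T x‖ ≤ 1), ENNReal.ofReal (∫ x in F, div2 T x)

/-- `F` has locally finite perimeter in `Ω`. -/
def LocFinPer (F : Set E2) (Ω : Set E2) : Prop :=
  MeasurableSet F ∧ ∀ Ω' : Set E2, IsOpen Ω' → IsCompact (closure Ω') → closure Ω' ⊆ Ω →
    perVar F Ω' < ⊤

/-- `E` is a `Λ`-local minimizer of `P_φ` in `Ω`. -/
def IsLambdaLocMinPer (φ : E2 → ℝ) (Λ : ℝ) (Ω : Set E2) (E : Set E2) : Prop :=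
  LocFinPer E Ω ∧ ∀ Ω' : Set E2, IsOpen Ω' → IsCompact (closure Ω') → closure Ω' ⊆ Ω →
    ∀ F : Set E2, LocFinPer F Ω → IsCompact (closure (E ∆ F)) → closure (E ∆ F) ⊆ Ω' →
      aniPer φ E Ω' ≤ aniPer φ F Ω' + ENNReal.ofReal Λ * volume (E ∆ F)

/-- The (strict) subgraph of `u` over `I`. -/
def subg (I : Set ℝ) (u : ℝ → ℝ) : Set E2 := {q : E2 | q 0 ∈ I ∧ q 1 < u (q 0)}

/-- The (strict) epigraph of `u` over `I`. -/
def epig (I : Set ℝ) (u : ℝ → ℝ) : Set E2 := {q : E2 | q 0 ∈ I ∧ u (q 0) < q 1}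

/-- The vertical strip `I × ℝ`. -/
def strip (I : Set ℝ) : Set E2 := {q : E2 | q 0 ∈ I}

/-- The vertical box `I × A`. -/
def box (I A : Set ℝ) : Set E2 := {q : E2 | q 0 ∈ I ∧ q 1 ∈ A}

/-- `u` is a `(γ,Λ)`-local minimizer of `𝒜_φ` in `I`. -/
def IsGammaLambdaLocMin (φ : E2 → ℝ) (γ Λ : ℝ) (I : Set ℝ) (u : ℝ → ℝ) : Prop :=
  ∀ Ω : Set E2, IsOpen Ω → IsCompact (closure Ω) → closure Ω ⊆ box I (Set.Ioo (-γ) γ) →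
    ∀ F : Set E2, LocFinPer F (strip I) →
      IsCompact (closure (subg I u ∆ F)) → closure (subg I u ∆ F) ⊆ Ω →
        aniPer φ (subg I u) Ω ≤ aniPer φ F Ω + ENNReal.ofReal Λ * volume (subg I u ∆ F)

/-- The constant `α₀(φ)`. -/
def alpha0 (φ : E2 → ℝ) : ℝ :=
  (aniPer φ (wulff φ) univ).toReal /
    ((2 * (aniPer φ (wulff φ) univ).toReal + 1) * Real.sqrt (volume (wulff φ)).toReal)

/-- `u` admits a Lipschitz representative on `I`. -/
def HasLipschitzRep (u : ℝ → ℝ) (I : Set ℝ) : Prop :=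
  ∃ v : ℝ → ℝ, (∀ᵐ s ∂(volume.restrict I), u s = v s) ∧ ∃ K : ℝ≥0, LipschitzOnWith K v I

/-- `u` admits a `C^{1,1}` representative on `I`. -/
def HasC11Rep (u : ℝ → ℝ) (I : Set ℝ) : Prop :=
  ∃ v v' : ℝ → ℝ, (∀ᵐ s ∂(volume.restrict I), u s = v s) ∧
    (∀ s ∈ I, HasDerivAt v (v' s) s) ∧ ∃ K : ℝ≥0, LipschitzOnWith K v' I

lemma norm_vec2_le_one_iff (x y : ℝ) : ‖vec2 x y‖ ≤ 1 ↔ x ^ 2 + y ^ 2 ≤ 1 := by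
  rw [EuclideanSpace.norm_eq, Real.sqrt_le_one]
  simp [vec2, Fin.sum_univ_two]

/-- A smooth cutoff equal to `1` on `[-r, r]` and supported in `[-R, R]`. -/
lemma exists_smooth_cutoff {r R : ℝ} (hr : 0 < r) (hrR : r < R) :
    ∃ χ : ℝ → ℝ, ContDiff ℝ 1 χ ∧ HasCompactSupport χ ∧ tsupport χ ⊆ Icc (-R) R ∧
      (∀ s, 0 ≤ χ s ∧ χ s ≤ 1) ∧ ∀ s, |s| ≤ r → χ s = 1 := by
  let f : ContDiffBump (0 : ℝ) := ⟨r, R, hr, hrR⟩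
  refine ⟨f, f.contDiff, f.hasCompactSupport, ?_, fun s => ⟨f.nonneg, f.le_one⟩, fun s hs => ?_⟩
  · rw [f.tsupport_eq, Real.closedBall_eq_Icc]
    simp [f]
  · exact f.one_of_mem_closedBall (by simpa [f, Real.dist_eq] using hs)

/-- The forward Steklov average of a continuous function. -/
def steklov (H : ℝ → ℝ) (δ s : ℝ) : ℝ :=
  δ⁻¹ * ((∫ t in (0:ℝ)..(s + δ), H t) - ∫ t in (0:ℝ)..s, H t)

section Steklov

variable {H : ℝ → ℝ}

lemma steklov_eq (hH : Continuous H) (δ s : ℝ) :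
    steklov H δ s = δ⁻¹ * ∫ t in s..(s + δ), H t := by
  rw [steklov, intervalIntegral.integral_interval_sub_left] <;>
    exact hH.intervalIntegrable _ _

lemma hasDerivAt_primitive (hH : Continuous H) (s : ℝ) :
    HasDerivAt (fun x => ∫ t in (0:ℝ)..x, H t) (H s) s :=
  intervalIntegral.integral_hasDerivAt_right (hH.intervalIntegrable _ _)
    (hH.stronglyMeasurableAtFilter _ _) hH.continuousAt

lemma hasDerivAt_steklov (hH : Continuous H) (δ s : ℝ) :
    HasDerivAt (steklov H δ) (δ⁻¹ * (H (s + δ) - H s)) s :=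
  (((hasDerivAt_primitive hH (s + δ)).comp_add_const s δ).sub
    (hasDerivAt_primitive hH s)).const_mul _

lemma deriv_steklov (hH : Continuous H) (δ : ℝ) :
    deriv (steklov H δ) = fun s => δ⁻¹ * (H (s + δ) - H s) :=
  funext fun s => (hasDerivAt_steklov hH δ s).deriv

lemma contDiff_steklov (hH : Continuous H) (δ : ℝ) : ContDiff ℝ 1 (steklov H δ) := by
  rw [contDiff_one_iff_deriv]
  refine ⟨fun s => (hasDerivAt_steklov hH δ s).differentiableAt, ?_⟩
  rw [deriv_steklov hH]
  fun_prop

lemma abs_steklov_le (hH : Continuous H) {c δ : ℝ} (hδ : 0 < δ) (hc : ∀ s, |H s| ≤ c) (s : ℝ) :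
    |steklov H δ s| ≤ c := by
  rw [steklov_eq hH, abs_mul, abs_inv, abs_of_pos hδ]
  have h := intervalIntegral.norm_integral_le_of_norm_le_const (a := s) (b := s + δ) (f := H)
    (C := c) fun x _ => hc x
  rw [Real.norm_eq_abs, add_sub_cancel_left, abs_of_pos hδ] at h
  rw [inv_mul_le_iff₀ hδ]
  linarith

lemma steklov_eq_zero (hH : Continuous H) {r δ : ℝ} (hδ : 0 < δ) (hr : ∀ s, r ≤ |s| → H s = 0)
    {s : ℝ} (hs : r + δ ≤ |s|) : steklov H δ s = 0 := by
  rw [steklov_eq hH, intervalIntegral.integral_zero_ae, mul_zero]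
  refine Eventually.of_forall fun t ht => hr t ?_
  rw [uIoc_of_le (by linarith)] at ht
  rcases le_abs.1 hs with h | h
  · exact le_abs.2 (.inl (by linarith [ht.1]))
  · exact le_abs.2 (.inr (by linarith [ht.2]))

lemma tendsto_steklov (hH : Continuous H) (s : ℝ) :
    Tendsto (fun δ => steklov H δ s) (𝓝[>] 0) (𝓝 (H s)) :=
  (hasDerivAt_primitive hH s).tendsto_slope_zero_right

end Steklov

lemma tsupport_subset_Icc {h : ℝ → ℝ} {r : ℝ} (hr : ∀ s, r ≤ |s| → h s = 0) :
    tsupport h ⊆ Icc (-r) r := by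
  refine closure_minimal (fun s hs => ?_) isClosed_Icc
  refine abs_le.1 ?_
  by_contra hlt
  exact hs (hr s (not_le.1 hlt).le)

lemma ofReal_integral_le_aniArea_of_contDiff {v h₁ h₂ : ℝ → ℝ} {r : ℝ} (hr : r < 1)
    (h₁c : ContDiff ℝ 1 h₁) (h₂c : ContDiff ℝ 1 h₂)
    (h₁r : ∀ s, r ≤ |s| → h₁ s = 0) (h₂r : ∀ s, r ≤ |s| → h₂ s = 0)
    (hle : ∀ s, h₁ s ^ 2 + h₂ s ^ 2 ≤ 1) :
    ENNReal.ofReal (∫ s in Ioo (-1:ℝ) 1, (v s * deriv h₁ s + h₂ s)) ≤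
      aniArea (fun x : E2 => ‖x‖) v (Ioo (-1:ℝ) 1) := by
  have hsub : Icc (-r) r ⊆ Ioo (-1:ℝ) 1 := Icc_subset_Ioo (by linarith) hr
  have hcpt : ∀ {h : ℝ → ℝ}, (∀ s, r ≤ |s| → h s = 0) → HasCompactSupport h := fun hh =>
    isCompact_Icc.of_isClosed_subset (isClosed_tsupport _) (tsupport_subset_Icc hh)
  exact le_iSup_of_le h₁ <| le_iSup_of_le h₂ <| le_iSup_of_le h₁c <| le_iSup_of_le h₂c <|
    le_iSup_of_le (hcpt h₁r) <| le_iSup_of_le (hcpt h₂r) <|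
    le_iSup_of_le ((tsupport_subset_Icc h₁r).trans hsub) <|
    le_iSup_of_le ((tsupport_subset_Icc h₂r).trans hsub) <|
    le_iSup_of_le (fun s _ => (norm_vec2_le_one_iff _ _).2 (hle s)) le_rfl

/-- Lipschitz calibrations `(H, √(1 - H²))` are admissible lower bounds for the relaxed area. -/
lemma ofReal_integral_le_aniArea {v H k : ℝ → ℝ} {K : ℝ≥0} {c r : ℝ}
    (hv : IntegrableOn v (Ioo (-1:ℝ) 1)) (hK : LipschitzWith K H) (hc : c < 1)
    (hHc : ∀ s, |H s| ≤ c) (hr : r < 1) (hHr : ∀ s, r ≤ |s| → H s = 0)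
    (hk : ∀ᵐ s, HasDerivAt H (k s) s) :
    ENNReal.ofReal (∫ s in Ioo (-1:ℝ) 1, (v s * k s + √(1 - H s ^ 2))) ≤
      aniArea (fun x : E2 => ‖x‖) v (Ioo (-1:ℝ) 1) := by
  have hH := hK.continuous
  have hcut : ∀ δ : ℝ, ∃ χ : ℝ → ℝ, 0 < δ ∧ δ < 1 / 4 → ContDiff ℝ 1 χ ∧
      tsupport χ ⊆ Icc (-(1 - δ)) (1 - δ) ∧ (∀ s, 0 ≤ χ s ∧ χ s ≤ 1) ∧
      ∀ s, |s| ≤ 1 - 2 * δ → χ s = 1 := by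
    intro δ
    by_cases hδ : 0 < δ ∧ δ < 1 / 4
    · obtain ⟨χ, h1, -, h2, h3, h4⟩ :=
        exists_smooth_cutoff (r := 1 - 2 * δ) (R := 1 - δ) (by linarith) (by linarith)
      exact ⟨χ, fun _ => ⟨h1, h2, h3, h4⟩⟩
    · exact ⟨0, fun h => absurd h hδ⟩
  choose χ hχ using hcut
  have hsmall : ∀ {ε : ℝ}, 0 < ε → ∀ᶠ δ : ℝ in 𝓝[>] 0, 0 < δ ∧ δ < ε := fun hε => Ioo_mem_nhdsGT hε
  have hsq : ∀ {δ : ℝ}, 0 < δ → ∀ s, 0 < 1 - steklov H δ s ^ 2 := fun hδ s => by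
    have := abs_le.1 (abs_steklov_le hH hδ hHc s)
    nlinarith
  have hlim : Tendsto (fun δ => ∫ s in Ioo (-1:ℝ) 1,
      (v s * deriv (steklov H δ) s + χ δ s * √(1 - steklov H δ s ^ 2))) (𝓝[>] 0)
      (𝓝 (∫ s in Ioo (-1:ℝ) 1, (v s * k s + √(1 - H s ^ 2)))) := by
    refine tendsto_integral_filter_of_dominated_convergence (fun s => |v s| * K + 1) ?_ ?_ ?_ ?_
    · filter_upwards [hsmall (by norm_num : (0:ℝ) < 1 / 4)] with δ hδ
      have h1 := (contDiff_steklov hH δ).continuous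
      have h2 := (hχ δ hδ).1.continuous
      refine (hv.aestronglyMeasurable.mul ?_).add ?_
      · rw [deriv_steklov hH]
        exact Continuous.aestronglyMeasurable (by fun_prop)
      · exact Continuous.aestronglyMeasurable (by fun_prop)
    · filter_upwards [hsmall (by norm_num : (0:ℝ) < 1 / 4)] with δ hδ
      refine Eventually.of_forall fun s => (norm_add_le _ _).trans (add_le_add ?_ ?_)
      · rw [norm_mul, deriv_steklov hH, Real.norm_eq_abs]
        refine mul_le_mul_of_nonneg_left ?_ (abs_nonneg _)
        have := hK.dist_le_mul (s + δ) s
        rw [Real.dist_eq, Real.dist_eq, add_sub_cancel_left, abs_of_pos hδ.1] at this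
        rw [norm_mul, norm_inv, Real.norm_eq_abs, Real.norm_eq_abs, abs_of_pos hδ.1,
          inv_mul_le_iff₀ hδ.1]
        linarith
      · obtain ⟨h0, h1⟩ := (hχ δ hδ).2.2.1 s
        rw [Real.norm_eq_abs, abs_of_nonneg (by positivity)]
        refine mul_le_one₀ h1 (by positivity) ?_
        rw [Real.sqrt_le_one]
        nlinarith
    · exact (hv.abs.mul_const _).add (integrable_const _)
    · filter_upwards [ae_restrict_of_ae hk, ae_restrict_mem measurableSet_Ioo] with s hs hsI
      have h1 : Tendsto (fun δ => deriv (steklov H δ) s) (𝓝[>] 0) (𝓝 (k s)) := by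
        simp only [deriv_steklov hH]
        exact hs.tendsto_slope_zero_right
      have h2 : Tendsto (fun δ => χ δ s) (𝓝[>] 0) (𝓝 1) := by
        have hs1 : 0 < 1 - |s| := by linarith [abs_lt.2 ⟨hsI.1, hsI.2⟩]
        refine tendsto_const_nhds.congr' ?_
        filter_upwards [hsmall (by norm_num : (0:ℝ) < 1 / 4),
          hsmall (by linarith : 0 < (1 - |s|) / 2)] with δ hδ hδ'
        exact ((hχ δ hδ).2.2.2 s (by linarith [hδ'.2])).symm
      have h3 := ((tendsto_steklov hH s).pow 2).const_sub 1 |>.sqrt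
      simpa using (h1.const_mul (v s)).add (h2.mul h3)
  refine le_of_tendsto ((ENNReal.continuous_ofReal.tendsto _).comp hlim) ?_
  filter_upwards [hsmall (by norm_num : (0:ℝ) < 1 / 4),
    hsmall (by linarith : 0 < (1 - r) / 2)] with δ hδ hδ'
  obtain ⟨hc1, hsupp, h01, -⟩ := hχ δ hδ
  refine ofReal_integral_le_aniArea_of_contDiff (r := max ((1 + r) / 2) (1 - δ / 2))
    (max_lt (by linarith) (by linarith)) (contDiff_steklov hH δ) ?_ ?_ ?_ ?_
  · exact hc1.mul ((contDiff_const.sub ((contDiff_steklov hH δ).pow 2)).sqrt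
      fun s => (hsq hδ.1 s).ne')
  · exact fun s hs => steklov_eq_zero hH hδ.1 hHr
      (le_trans (by linarith [hδ'.2]) ((le_max_left _ _).trans hs))
  · intro s hs
    suffices h : s ∉ tsupport (χ δ) by rw [image_eq_zero_of_notMem_tsupport h, zero_mul]
    intro hmem
    have := abs_le.2 (hsupp hmem)
    linarith [(le_max_right ((1 + r) / 2) (1 - δ / 2)).trans hs, hδ.1]
  · intro s
    rw [mul_pow, Real.sq_sqrt (hsq hδ.1 s).le]
    nlinarith [h01 s, hsq hδ.1 s, mul_nonneg (h01 s).1 (sub_nonneg.2 (h01 s).2)]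

lemma integral_mul_add_mul_eq_zero {u u' f f' : ℝ → ℝ} {r : ℝ} (hr : r < 1)
    (hu : ∀ s ∈ Ioo (-1:ℝ) 1, HasDerivAt u (u' s) s) (hf : Continuous f)
    (hfr : ∀ s, r ≤ |s| → f s = 0) {S : Set ℝ} (hS : S.Countable)
    (hf' : ∀ s ∉ S, HasDerivAt f (f' s) s)
    (hint : IntegrableOn (fun s => u s * f' s + u' s * f s) (Ioo (-1:ℝ) 1)) :
    ∫ s in Ioo (-1:ℝ) 1, (u s * f' s + u' s * f s) = 0 := by
  have hcont : ∀ s, ContinuousAt (fun s => u s * f s) s := by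
    intro s
    by_cases hs : |s| < 1
    · exact (hu s (abs_lt.1 hs)).continuousAt.mul hf.continuousAt
    · have hev : ∀ᶠ x in 𝓝 s, r < |x| :=
        continuous_abs.continuousAt.eventually_const_lt (by linarith)
      refine (continuousAt_const (y := (0:ℝ))).congr ?_
      filter_upwards [hev] with x hx
      rw [hfr x hx.le, mul_zero]
  have hle : (-1:ℝ) ≤ 1 := by norm_num
  rw [← integral_Ioc_eq_integral_Ioo, ← intervalIntegral.integral_of_le hle,
    integral_eq_of_hasDerivAt_off_countable_of_le (fun s => u s * f s) _ hle hS
      (fun s _ => (hcont s).continuousWithinAt)]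
  · simp [hfr 1 (by simpa using hr.le), hfr (-1) (by simpa using hr.le)]
  · intro s hs
    exact ((hu s hs.1).mul (hf' s hs.2)).congr_deriv (add_comm _ _)
  · rwa [intervalIntegrable_iff_integrableOn_Ioo_of_le hle]

/-- A du Bois-Reymond lemma: a function supported away from `±1` whose distributional derivative
vanishes is zero. -/
lemma ae_eq_zero_of_integral_mul_deriv_eq_zero {w : ℝ → ℝ} {b : ℝ} (hb0 : 0 < b) (hb1 : b < 1)
    (hw : IntegrableOn w (Ioo (-1:ℝ) 1))
    (hwb : ∀ᵐ s ∂volume.restrict (Ioo (-1:ℝ) 1), b < |s| → w s = 0)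
    (h : ∀ ψ : ℝ → ℝ, ContDiff ℝ 1 ψ → ∀ r < 1, (∀ s, r ≤ |s| → ψ s = 0) →
      ∫ s in Ioo (-1:ℝ) 1, w s * deriv ψ s = 0) :
    ∀ᵐ s ∂volume.restrict (Ioo (-1:ℝ) 1), w s = 0 := by
  refine ae_eq_zero_of_integral_contDiff_smul_eq_zero hw.locallyIntegrable fun g hg _ => ?_
  obtain ⟨χ, hχ, -, hsupp, -, hone⟩ :=
    exists_smooth_cutoff (r := (1 + b) / 2) (R := (3 + b) / 4) (by linarith) (by linarith)
  set Φ : ℝ → ℝ := fun x => ∫ t in (0:ℝ)..x, g t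
  have hΦ : ∀ s, HasDerivAt Φ (g s) s := hasDerivAt_primitive hg.continuous
  have hΦc : ContDiff ℝ 1 Φ := by
    rw [contDiff_one_iff_deriv]
    refine ⟨fun s => (hΦ s).differentiableAt, ?_⟩
    rw [funext fun s => (hΦ s).deriv]
    exact hg.continuous
  have hψ := h (fun s => Φ s * χ s) (hΦc.mul hχ) ((7 + b) / 8) (by linarith) fun s hs => by
    suffices hn : s ∉ tsupport χ by rw [image_eq_zero_of_notMem_tsupport hn, mul_zero]
    intro hmem
    have := abs_le.2 (hsupp hmem)
    linarith
  rw [← hψ]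
  refine integral_congr_ae ?_
  filter_upwards [hwb] with s hs
  by_cases hsb : b < |s|
  · simp [hs hsb]
  · have hev : Φ =ᶠ[𝓝 s] fun s => Φ s * χ s := by
      have : ∀ᶠ x in 𝓝 s, |x| < (1 + b) / 2 :=
        continuous_abs.continuousAt.eventually_lt_const (by linarith)
      filter_upwards [this] with x hx
      rw [hone x hx.le, mul_one]
    rw [← hev.deriv_eq, (hΦ s).deriv, smul_eq_mul, mul_comm]

/-- A quantitative first-order expansion of `t ↦ √(1 - (-p + t)²)` from below. -/
lemma le_sqrt_one_sub_sq {m p t : ℝ} (hm : 0 < m) (hp : 0 ≤ p) (hpm : p ^ 2 ≤ 1 - m ^ 2)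
    (ht : |t| ≤ m ^ 2 / 3) :
    √(1 - p ^ 2) + p / √(1 - p ^ 2) * t - 3 / m ^ 3 * t ^ 2 ≤ √(1 - (-p + t) ^ 2) := by
  set q := √(1 - p ^ 2) with hq
  have hq2 : q ^ 2 = 1 - p ^ 2 := Real.sq_sqrt (by nlinarith)
  have hmq : m ≤ q := Real.le_sqrt_of_sq_le (by linarith)
  have hq0 : 0 < q := hm.trans_le hmq
  have hm1 : m ≤ 1 := by nlinarith
  have hp1 : p ≤ 1 := by nlinarith
  set A := p / q * t with hA
  have hAq : q * A = p * t := by rw [hA]; field_simp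
  have hpq : p / q ≤ 1 / m := div_le_div₀ zero_le_one hp1 hm hmq
  have hpq0 : 0 ≤ p / q := by positivity
  have hAt : |A| ≤ 1 / m * |t| := by
    rw [hA, abs_mul, abs_of_nonneg hpq0]
    gcongr
  have hAm : |A| ≤ m / 3 := by
    refine hAt.trans ?_
    calc 1 / m * |t| ≤ 1 / m * (m ^ 2 / 3) := by gcongr
      _ = m / 3 := by field_simp
  have hA2 : A ^ 2 ≤ 1 / m ^ 2 * t ^ 2 := by
    have := pow_le_pow_left₀ (abs_nonneg A) hAt 2
    rwa [sq_abs, mul_pow (1 / m), sq_abs, div_pow, one_pow] at this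
  set C := 3 / m ^ 3 with hC
  have hC0 : 0 < C := by positivity
  have hCt : C ^ 2 * t ^ 2 ≤ 1 / m ^ 2 := by
    have h2 := pow_le_pow_left₀ (abs_nonneg t) ht 2
    rw [sq_abs] at h2
    calc C ^ 2 * t ^ 2 ≤ C ^ 2 * (m ^ 2 / 3) ^ 2 := by gcongr
      _ = 1 / m ^ 2 := by rw [hC]; field_simp
  have hone : 1 ≤ 1 / m ^ 2 := by
    rw [le_div_iff₀ (by positivity)]
    nlinarith
  have hlow : 3 / m ^ 2 ≤ 2 * C * (q + A) := by
    have hqA : m / 2 ≤ q + A := by linarith [neg_abs_le A]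
    calc 3 / m ^ 2 = 2 * C * (m / 2) := by rw [hC]; field_simp
      _ ≤ 2 * C * (q + A) := by gcongr
  refine (le_abs_self _).trans (Real.abs_le_sqrt ?_)
  have hsum : C ^ 2 * t ^ 2 + 1 + 1 / m ^ 2 ≤ 2 * C * (q + A) := by
    have : 3 / m ^ 2 = 1 / m ^ 2 + 1 / m ^ 2 + 1 / m ^ 2 := by ring
    linarith
  nlinarith [mul_le_mul_of_nonneg_right hsum (sq_nonneg t)]

/-- The tent of height and half-width `b`. -/
def tent (b s : ℝ) : ℝ := max (b - |s|) 0

/-- The derivative of `-tent b`. -/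
def tentSign (b s : ℝ) : ℝ := if |s| < b then (if 0 < s then 1 else -1) else 0

/-- The slope `p / √(1 - p²)` of the graph whose unit tangent has vertical component
`p = tent b s`. -/
def tentSlope (b s : ℝ) : ℝ := tent b s / √(1 - tent b s ^ 2)

section Tent

variable {b : ℝ}

lemma tent_nonneg (b s : ℝ) : 0 ≤ tent b s := le_max_right _ _

lemma tent_le (hb : 0 ≤ b) (s : ℝ) : tent b s ≤ b :=
  max_le (by linarith [abs_nonneg s]) hb

lemma tent_of_le {s : ℝ} (hs : b ≤ |s|) : tent b s = 0 := max_eq_right (by linarith)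

lemma tent_of_ge {s : ℝ} (hs : |s| ≤ b) : tent b s = b - |s| := max_eq_left (by linarith)

lemma tent_sq_lt_one (hb0 : 0 ≤ b) (hb1 : b < 1) (s : ℝ) : 0 < 1 - tent b s ^ 2 := by
  nlinarith [tent_nonneg b s, tent_le hb0 s]

lemma lipschitzWith_tent (b : ℝ) : LipschitzWith 1 (tent b) := by
  refine LipschitzWith.of_dist_le_mul fun x y => ?_
  rw [Real.dist_eq, Real.dist_eq, NNReal.coe_one, one_mul]
  refine (abs_max_sub_max_le_abs _ _ _).trans ?_
  rw [sub_sub_sub_cancel_left, abs_sub_comm x y]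
  exact abs_abs_sub_abs_le _ _

lemma continuous_tent (b : ℝ) : Continuous (tent b) := (lipschitzWith_tent b).continuous

lemma hasDerivAt_neg_tent {s : ℝ} (hs0 : s ≠ 0) (hsb : |s| ≠ b) :
    HasDerivAt (fun s => -tent b s) (tentSign b s) s := by
  rcases lt_or_gt_of_ne hsb with h | h
  · have hev : (fun s => |s| - b) =ᶠ[𝓝 s] fun s => -tent b s := by
      filter_upwards [continuous_abs.continuousAt.eventually_lt_const h] with x hx
      rw [tent_of_ge hx.le, neg_sub]
    refine HasDerivAt.congr_of_eventuallyEq ?_ hev.symm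
    rw [tentSign, if_pos h]
    rcases lt_or_gt_of_ne hs0 with h0 | h0
    · rw [if_neg h0.not_gt]
      exact (hasDerivAt_abs_neg h0).sub_const b
    · rw [if_pos h0]
      exact (hasDerivAt_abs_pos h0).sub_const b
  · have hev : (fun _ => (0:ℝ)) =ᶠ[𝓝 s] fun s => -tent b s := by
      filter_upwards [continuous_abs.continuousAt.eventually_const_lt h] with x hx
      rw [tent_of_le hx.le, neg_zero]
    rw [tentSign, if_neg h.not_gt]
    exact (hasDerivAt_const s 0).congr_of_eventuallyEq hev.symm

lemma hasDerivAt_neg_tent_of_notMem {s : ℝ} (hs : s ∉ ({0, b, -b} : Set ℝ)) :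
    HasDerivAt (fun s => -tent b s) (tentSign b s) s := by
  simp only [mem_insert_iff, mem_singleton_iff, not_or] at hs
  refine hasDerivAt_neg_tent hs.1 fun h => ?_
  rcases eq_or_eq_neg_of_abs_eq h with h | h
  exacts [hs.2.1 h, hs.2.2 h]

lemma countable_kinks (b : ℝ) : ({0, b, -b} : Set ℝ).Countable := (toFinite _).countable

lemma ae_hasDerivAt_neg_tent (b : ℝ) :
    ∀ᵐ s, HasDerivAt (fun s => -tent b s) (tentSign b s) s := by
  filter_upwards [(countable_kinks b).ae_notMem volume] with s hs
  exact hasDerivAt_neg_tent_of_notMem hs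

lemma measurable_tentSign (b : ℝ) : Measurable (tentSign b) :=
  Measurable.ite (measurableSet_lt continuous_abs.measurable measurable_const)
    (Measurable.ite (measurableSet_lt measurable_const measurable_id) measurable_const
      measurable_const) measurable_const

lemma abs_tentSign_le (b s : ℝ) : |tentSign b s| ≤ 1 := by
  unfold tentSign
  split_ifs <;> simp

lemma continuous_tentSlope (hb0 : 0 ≤ b) (hb1 : b < 1) : Continuous (tentSlope b) :=
  (continuous_tent b).div₀ (continuous_const.sub ((continuous_tent b).pow 2)).sqrt
    fun s => (Real.sqrt_pos.2 (tent_sq_lt_one hb0 hb1 s)).ne'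

lemma exists_lipschitzWith_tentSlope (hb0 : 0 ≤ b) (hb1 : b < 1) :
    ∃ K, LipschitzWith K (tentSlope b) := by
  have hcd : ContDiffOn ℝ 1 (fun x : ℝ => x / √(1 - x ^ 2)) (Icc 0 b) := by
    have hpos : ∀ x ∈ Icc 0 b, 0 < 1 - x ^ 2 := fun x hx => by nlinarith [hx.1, hx.2]
    exact contDiffOn_id.div
      ((contDiff_const.sub (contDiff_id.pow 2)).contDiffOn.sqrt fun x hx => (hpos x hx).ne')
      fun x hx => (Real.sqrt_pos.2 (hpos x hx)).ne'
  obtain ⟨K, hK⟩ := hcd.exists_lipschitzOnWith one_ne_zero (convex_Icc 0 b) isCompact_Icc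
  refine ⟨K * 1, ?_⟩
  rw [← lipschitzOnWith_univ]
  exact hK.comp (lipschitzWith_tent b).lipschitzOnWith
    fun s _ => ⟨tent_nonneg b s, tent_le hb0 s⟩

end Tent

lemma hasDerivAt_max_zero_sq (x : ℝ) : HasDerivAt (fun y : ℝ => max y 0 ^ 2) (2 * max x 0) x := by
  refine hasDerivAt_of_hasDerivAt_of_ne' (f := fun y : ℝ => max y 0 ^ 2)
    (g := fun y => 2 * max y 0) (x := 0) (fun y hy => ?_)
    (by fun_prop) (by fun_prop) x
  rcases lt_or_gt_of_ne hy with h | h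
  · rw [max_eq_right h.le, mul_zero]
    refine (hasDerivAt_const y 0).congr_of_eventuallyEq ?_
    filter_upwards [eventually_lt_nhds h] with z hz
    simp [max_eq_right hz.le]
  · rw [max_eq_left h.le]
    refine HasDerivAt.congr_of_eventuallyEq (by simpa using hasDerivAt_pow 2 y) ?_
    filter_upwards [eventually_gt_nhds h] with z hz
    simp [max_eq_left hz.le]

lemma hasDerivAt_sqrt_one_sub_max_zero_sq {x : ℝ} (hx : x < 1) :
    HasDerivAt (fun y : ℝ => √(1 - max y 0 ^ 2)) (-(max x 0 / √(1 - max x 0 ^ 2))) x := by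
  have hpos : 0 < 1 - max x 0 ^ 2 := by
    rcases le_total x 0 with h | h
    · simp [max_eq_right h]
    · rw [max_eq_left h]
      nlinarith
  refine (((hasDerivAt_max_zero_sq x).const_sub 1).sqrt hpos.ne').congr_deriv ?_
  have := (Real.sqrt_pos.2 hpos).ne'
  field_simp

/-- The glued pair of circular arcs has derivative `tentSlope b` throughout the interval. -/
lemma hasDerivAt_arcs {a b : ℝ} {u : ℝ → ℝ} (hb1 : b < 1)
    (hpos : ∀ s ∈ Ico (0:ℝ) 1, u s = a - 1 + √(1 - tent b s ^ 2))
    (hneg : ∀ s ∈ Ioc (-1:ℝ) 0, u s = 1 - a - √(1 - tent b s ^ 2))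
    {s : ℝ} (hs : s ∈ Ioo (-1:ℝ) 1) : HasDerivAt u (tentSlope b s) s := by
  have hR : 0 ≤ s → HasDerivAt (fun s => a - 1 + √(1 - max (b - s) 0 ^ 2)) (tentSlope b s) s := by
    intro h
    have := ((hasDerivAt_sqrt_one_sub_max_zero_sq (x := b - s) (by linarith)).comp_const_sub b s
      ).const_add (a - 1)
    rwa [neg_neg, ← abs_of_nonneg h, ← tent, ← tentSlope, abs_of_nonneg h] at this
  have hL : s ≤ 0 → HasDerivAt (fun s => 1 - a - √(1 - max (b + s) 0 ^ 2)) (tentSlope b s) s := by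
    intro h
    have := ((hasDerivAt_sqrt_one_sub_max_zero_sq (x := b + s) (by linarith)).comp_const_add b s
      ).const_sub (1 - a)
    have he : max (b + s) 0 = tent b s := by rw [tent, abs_of_nonpos h, sub_neg_eq_add]
    rwa [neg_neg, he, ← tentSlope] at this
  have hRe : ∀ x ∈ Ico (0:ℝ) 1, u x = a - 1 + √(1 - max (b - x) 0 ^ 2) := fun x hx => by
    rw [hpos x hx, tent, abs_of_nonneg hx.1]
  have hLe : ∀ x ∈ Ioc (-1:ℝ) 0, u x = 1 - a - √(1 - max (b + x) 0 ^ 2) := fun x hx => by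
    rw [hneg x hx, tent, abs_of_nonpos hx.2, sub_neg_eq_add]
  rcases lt_trichotomy s 0 with h | rfl | h
  · refine (hL h.le).congr_of_eventuallyEq ?_
    filter_upwards [Ioo_mem_nhds hs.1 h] with x hx
    exact hLe x ⟨hx.1, hx.2.le⟩
  · rw [← hasDerivWithinAt_univ, ← Iic_union_Ici (a := (0:ℝ))]
    refine HasDerivWithinAt.union ?_ ?_
    · refine (hL le_rfl).hasDerivWithinAt.congr_of_eventuallyEq ?_ (hLe 0 (by norm_num))
      filter_upwards [inter_mem self_mem_nhdsWithin
        (mem_nhdsWithin_of_mem_nhds (Ioo_mem_nhds hs.1 hs.2))] with x hx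
      exact hLe x ⟨hx.2.1, hx.1⟩
    · refine (hR le_rfl).hasDerivWithinAt.congr_of_eventuallyEq ?_ (hRe 0 (by norm_num))
      filter_upwards [inter_mem self_mem_nhdsWithin
        (mem_nhdsWithin_of_mem_nhds (Ioo_mem_nhds hs.1 hs.2))] with x hx
      exact hRe x ⟨hx.1, hx.2.2⟩
  · refine (hR h.le).congr_of_eventuallyEq ?_
    filter_upwards [Ioo_mem_nhds h hs.2] with x hx
    exact hRe x ⟨hx.1.le, hx.2⟩

/-- `tentSlope b` has a corner at `b`. -/
lemma not_differentiableAt_tentSlope {b : ℝ} (hb0 : 0 < b) :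
    ¬ DifferentiableAt ℝ (tentSlope b) b := by
  intro hd
  have hzero : tentSlope b b = 0 := by simp [tentSlope, tent_of_le (le_abs_self b)]
  have h1 : HasDerivWithinAt (tentSlope b) 0 (Ici b) b := by
    refine (hasDerivWithinAt_const b _ 0).congr (fun x hx => ?_) hzero
    simp [tentSlope, tent_of_le (hx.trans (le_abs_self x))]
  have h2 : HasDerivWithinAt (tentSlope b) (-1) (Iic b) b := by
    have h3 : HasDerivAt (fun x : ℝ => (b - x) / √(1 - (b - x) ^ 2)) (-1) b := by
      have hn := (hasDerivAt_id b).const_sub b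
      have hden : HasDerivAt (fun x : ℝ => √(1 - (b - x) ^ 2)) _ b :=
        ((hn.pow 2).const_sub 1).sqrt (by simp)
      exact (hn.div hden (by simp)).congr_deriv (by simp)
    refine h3.hasDerivWithinAt.congr_of_eventuallyEq ?_ (by simp [hzero])
    filter_upwards [inter_mem self_mem_nhdsWithin
      (mem_nhdsWithin_of_mem_nhds (Ioi_mem_nhds hb0))] with x hx
    have hx0 : 0 < x := hx.2
    have hxb : x ≤ b := hx.1
    rw [tentSlope, tent_of_ge (by rwa [abs_of_pos hx0]), abs_of_pos hx0]
  have e1 := (uniqueDiffWithinAt_Ici b).eq_deriv _ h1 hd.hasDerivAt.hasDerivWithinAt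
  have e2 := (uniqueDiffWithinAt_Iic b).eq_deriv _ h2 hd.hasDerivAt.hasDerivWithinAt
  linarith

lemma not_contDiffOn_two_of_hasDerivAt_tentSlope {b : ℝ} {u : ℝ → ℝ} (hb0 : 0 < b) (hb1 : b < 1)
    (hu : ∀ s ∈ Ioo (-1:ℝ) 1, HasDerivAt u (tentSlope b s) s) :
    ¬ ContDiffOn ℝ 2 u (Ioo (-1:ℝ) 1) := by
  intro h
  have hnhds : Ioo (-1:ℝ) 1 ∈ 𝓝 b := Ioo_mem_nhds (by linarith) hb1
  have hd : DifferentiableAt ℝ (deriv u) b :=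
    ((h.deriv_of_isOpen isOpen_Ioo (m := 1) (by norm_num)).differentiableOn one_ne_zero
      ).differentiableAt hnhds
  refine not_differentiableAt_tentSlope hb0 (hd.congr_of_eventuallyEq ?_)
  filter_upwards [hnhds] with s hs
  exact (hu s hs).deriv.symm

lemma integrableOn_mul_of_continuous {v f : ℝ → ℝ} (hv : IntegrableOn v (Ioo (-1:ℝ) 1))
    (hf : Continuous f) : IntegrableOn (fun s => v s * f s) (Ioo (-1:ℝ) 1) :=
  hv.mul_continuousOn_of_subset hf.continuousOn measurableSet_Ioo isCompact_Icc Ioo_subset_Icc_self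

lemma integrableOn_mul_tentSign {v : ℝ → ℝ} (hv : IntegrableOn v (Ioo (-1:ℝ) 1)) (b : ℝ) :
    IntegrableOn (fun s => v s * tentSign b s) (Ioo (-1:ℝ) 1) := by
  refine hv.norm.mono' (hv.aestronglyMeasurable.mul
    (measurable_tentSign b).aestronglyMeasurable) (Eventually.of_forall fun s => ?_)
  rw [norm_mul]
  exact mul_le_of_le_one_right (norm_nonneg _) (abs_tentSign_le b s)

lemma integrableOn_of_continuous {f : ℝ → ℝ} (hf : Continuous f) :
    IntegrableOn f (Ioo (-1:ℝ) 1) := hf.integrableOn_Icc.mono_set Ioo_subset_Icc_self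

/-- The pairing of `v` with the calibration `(-tent b, √(1 - tent b ^ 2))`. -/
def tentPairing (b : ℝ) (v : ℝ → ℝ) : ℝ :=
  ∫ s in Ioo (-1:ℝ) 1, (v s * tentSign b s + √(1 - tent b s ^ 2))

section Calibration

variable {b : ℝ}

lemma continuous_sqrt_one_sub_tent_sq (b : ℝ) : Continuous fun s => √(1 - tent b s ^ 2) :=
  (continuous_const.sub ((continuous_tent b).pow 2)).sqrt

lemma integrableOn_tentPairing {v : ℝ → ℝ} (hv : IntegrableOn v (Ioo (-1:ℝ) 1)) (b : ℝ) :
    IntegrableOn (fun s => v s * tentSign b s + √(1 - tent b s ^ 2)) (Ioo (-1:ℝ) 1) :=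
  (integrableOn_mul_tentSign hv b).add
    (integrableOn_of_continuous (continuous_sqrt_one_sub_tent_sq b))

lemma ofReal_tentPairing_le_aniArea (hb0 : 0 ≤ b) (hb1 : b < 1) {v : ℝ → ℝ}
    (hv : IntegrableOn v (Ioo (-1:ℝ) 1)) :
    ENNReal.ofReal (tentPairing b v) ≤ aniArea (fun x : E2 => ‖x‖) v (Ioo (-1:ℝ) 1) := by
  have h := ofReal_integral_le_aniArea hv (lipschitzWith_tent b).neg hb1
    (fun s => by
      rw [Pi.neg_apply, abs_neg, abs_of_nonneg (tent_nonneg b s)]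
      exact tent_le hb0 s)
    hb1 (fun s hs => by rw [Pi.neg_apply, tent_of_le hs, neg_zero]) (ae_hasDerivAt_neg_tent b)
  simpa [tentPairing] using h

/-- The calibration is sharp for a function with derivative `tentSlope b`. -/
lemma aniArea_le_ofReal_tentPairing (hb0 : 0 ≤ b) (hb1 : b < 1) {u : ℝ → ℝ}
    (hu : IntegrableOn u (Ioo (-1:ℝ) 1))
    (hu' : ∀ s ∈ Ioo (-1:ℝ) 1, HasDerivAt u (tentSlope b s) s) :
    aniArea (fun x : E2 => ‖x‖) u (Ioo (-1:ℝ) 1) ≤ ENNReal.ofReal (tentPairing b u) := by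
  have hslope := continuous_tentSlope hb0 hb1
  have hparts : ∫ s in Ioo (-1:ℝ) 1, (u s * tentSign b s + tentSlope b s * -tent b s) = 0 :=
    integral_mul_add_mul_eq_zero hb1 hu' (continuous_tent b).neg
      (fun s hs => by rw [tent_of_le hs, neg_zero]) (countable_kinks b)
      (fun s hs => hasDerivAt_neg_tent_of_notMem hs)
      ((integrableOn_mul_tentSign hu b).add
        (integrableOn_of_continuous (hslope.mul (continuous_tent b).neg)))
  unfold aniArea
  refine iSup_le fun h₁ => iSup_le fun h₂ => iSup_le fun h₁c => iSup_le fun h₂c =>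
    iSup_le fun _ => iSup_le fun _ => iSup_le fun h₁s => iSup_le fun _ =>
    iSup_le fun hle => ENNReal.ofReal_le_ofReal ?_
  obtain ⟨r, hr, hsub⟩ := exists_pos_lt_subset_ball (x := (0:ℝ)) zero_lt_one
    (isClosed_tsupport h₁) (by rwa [Real.ball_eq_Ioo, zero_sub, zero_add])
  have hh₁ : ∀ s, r ≤ |s| → h₁ s = 0 := fun s hs => by
    refine image_eq_zero_of_notMem_tsupport fun hmem => ?_
    have := hsub hmem
    rw [Metric.mem_ball, Real.dist_eq, sub_zero] at this
    linarith
  have hd : Continuous (deriv h₁) := h₁c.continuous_deriv le_rfl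
  have hI1 : IntegrableOn (fun s => u s * deriv h₁ s + tentSlope b s * h₁ s) (Ioo (-1:ℝ) 1) :=
    (integrableOn_mul_of_continuous hu hd).add
      (integrableOn_of_continuous (hslope.mul h₁c.continuous))
  have hparts₁ := integral_mul_add_mul_eq_zero hr.2 hu' h₁c.continuous hh₁ countable_empty
    (fun s _ => (h₁c.differentiable one_ne_zero s).hasDerivAt) hI1
  have hI2 : IntegrableOn (fun s => h₂ s - tentSlope b s * h₁ s) (Ioo (-1:ℝ) 1) :=
    integrableOn_of_continuous (h₂c.continuous.sub (hslope.mul h₁c.continuous))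
  have hI3 : IntegrableOn (fun s => tentSlope b s * tent b s + √(1 - tent b s ^ 2))
      (Ioo (-1:ℝ) 1) :=
    integrableOn_of_continuous
      ((hslope.mul (continuous_tent b)).add (continuous_sqrt_one_sub_tent_sq b))
  calc ∫ s in Ioo (-1:ℝ) 1, (u s * deriv h₁ s + h₂ s)
      = ∫ s in Ioo (-1:ℝ) 1, ((u s * deriv h₁ s + tentSlope b s * h₁ s)
          + (h₂ s - tentSlope b s * h₁ s)) := by
        congr 1 with s
        ring
    _ = ∫ s in Ioo (-1:ℝ) 1, (h₂ s - tentSlope b s * h₁ s) := by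
        rw [integral_add hI1 hI2, hparts₁, zero_add]
    _ ≤ ∫ s in Ioo (-1:ℝ) 1, (tentSlope b s * tent b s + √(1 - tent b s ^ 2)) := by
        refine setIntegral_mono_on hI2 hI3 measurableSet_Ioo fun s hs => ?_
        have hn := (norm_vec2_le_one_iff _ _).1 (hle s hs)
        have hp := tent_sq_lt_one hb0 hb1 s
        have hq := Real.sqrt_pos.2 hp
        have hq2 := Real.sq_sqrt hp.le
        rw [tentSlope]
        set p := tent b s
        set q := √(1 - p ^ 2)
        have hcs : q * h₂ s - p * h₁ s ≤ p * p + q * q := by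
          nlinarith [sq_nonneg (q - h₂ s), sq_nonneg (p + h₁ s)]
        calc h₂ s - p / q * h₁ s = (q * h₂ s - p * h₁ s) / q := by field_simp
          _ ≤ (p * p + q * q) / q := by gcongr
          _ = p / q * p + q := by field_simp
    _ = ∫ s in Ioo (-1:ℝ) 1, ((u s * tentSign b s + tentSlope b s * -tent b s)
          + (tentSlope b s * tent b s + √(1 - tent b s ^ 2))) := by
        rw [integral_add _ hI3, hparts, zero_add]
        exact (integrableOn_mul_tentSign hu b).add
          (integrableOn_of_continuous (hslope.mul (continuous_tent b).neg))
    _ = tentPairing b u := by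
        rw [tentPairing]
        congr 1 with s
        ring

/-- Equality in the calibration inequality forces the distributional derivative of `v` to be
`tentSlope b`. -/
lemma integral_mul_deriv_add_tentSlope_mul_eq_zero (hb0 : 0 ≤ b) (hb1 : b < 1) {v : ℝ → ℝ}
    (hv : IntegrableOn v (Ioo (-1:ℝ) 1))
    (hmax : aniArea (fun x : E2 => ‖x‖) v (Ioo (-1:ℝ) 1) ≤ ENNReal.ofReal (tentPairing b v))
    {ψ : ℝ → ℝ} (hψ : ContDiff ℝ 1 ψ) {r : ℝ} (hr : r < 1) (hψr : ∀ s, r ≤ |s| → ψ s = 0) :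
    ∫ s in Ioo (-1:ℝ) 1, (v s * deriv ψ s + tentSlope b s * ψ s) = 0 := by
  have hvol : volume.real (Ioo (-1:ℝ) 1) = 2 := by norm_num
  have hpos : 0 < tentPairing b v := by
    have h := (ofReal_integral_le_aniArea (H := fun _ => 0) (k := fun _ => 0) (K := 0) (c := 0)
      (r := 0) hv (LipschitzWith.const 0) one_pos (fun _ => by simp) one_pos (fun _ _ => rfl)
      (Eventually.of_forall fun s => hasDerivAt_const s 0)).trans hmax
    by_contra hn
    rw [ENNReal.ofReal_of_nonpos (not_lt.1 hn)] at h
    norm_num [hvol] at h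
  have hcs : HasCompactSupport ψ :=
    isCompact_Icc.of_isClosed_subset (isClosed_tsupport _) (tsupport_subset_Icc hψr)
  obtain ⟨M, hM⟩ := hψ.continuous.bounded_above_of_compact_support hcs
  obtain ⟨K, hK⟩ := hψ.lipschitzWith_of_hasCompactSupport hcs one_ne_zero
  set m := √(1 - b ^ 2) with hm
  have hb2 : 0 < 1 - b ^ 2 := by nlinarith
  have hm0 : 0 < m := Real.sqrt_pos.2 hb2
  have hm2 : m ^ 2 = 1 - b ^ 2 := Real.sq_sqrt hb2.le
  set L := ∫ s in Ioo (-1:ℝ) 1, (v s * deriv ψ s + tentSlope b s * ψ s) with hL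
  have hLint : IntegrableOn (fun s => v s * deriv ψ s + tentSlope b s * ψ s) (Ioo (-1:ℝ) 1) :=
    (integrableOn_mul_of_continuous hv (hψ.continuous_deriv le_rfl)).add
      (integrableOn_of_continuous ((continuous_tentSlope hb0 hb1).mul hψ.continuous))
  set D := 3 / m ^ 3 * M ^ 2 with hD
  have hsmall : ∀ η > 0, ∀ᶠ ε : ℝ in 𝓝 0, |ε| * M < η := fun η hη => by
    have hc : ContinuousAt (fun ε : ℝ => |ε| * M) 0 := by fun_prop
    exact hc.eventually_lt_const (by simpa using hη)
  have hlocal : IsLocalMax (fun ε => ε * L - 2 * D * ε ^ 2) 0 := by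
    filter_upwards [hsmall (m ^ 2 / 3) (by positivity), hsmall ((1 - b) / 2) (by linarith)]
      with ε hε hε'
    have hεψ : ∀ s, |ε * ψ s| ≤ |ε| * M := fun s => by
      rw [abs_mul]
      exact mul_le_mul_of_nonneg_left (hM s) (abs_nonneg _)
    have hH : Continuous fun s => -tent b s + ε * ψ s :=
      (continuous_tent b).neg.add (continuous_const.mul hψ.continuous)
    have hle := (ofReal_integral_le_aniArea (H := fun s => -tent b s + ε * ψ s)
      (k := fun s => tentSign b s + ε * deriv ψ s) (c := (1 + b) / 2) (r := max b r) hv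
      ((lipschitzWith_tent b).neg.add ((lipschitzWith_smul ε).comp hK)) (by linarith)
      (fun s => (abs_add_le _ _).trans (by
        rw [abs_neg, abs_of_nonneg (tent_nonneg b s)]
        linarith [hεψ s, tent_le hb0 s])) (max_lt hb1 hr)
      (fun s hs => by
        rw [tent_of_le ((le_max_left _ _).trans hs), hψr s ((le_max_right _ _).trans hs)]
        simp)
      ((ae_hasDerivAt_neg_tent b).mono fun s hs =>
        hs.add ((hψ.differentiable one_ne_zero s).hasDerivAt.const_mul ε))).trans hmax
    rw [ENNReal.ofReal_le_ofReal_iff hpos.le] at hle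
    have hI : IntegrableOn (fun s => v s * (tentSign b s + ε * deriv ψ s)
        + √(1 - (-tent b s + ε * ψ s) ^ 2)) (Ioo (-1:ℝ) 1) := by
      refine IntegrableOn.add ?_ (integrableOn_of_continuous
        (continuous_const.sub (hH.pow 2)).sqrt)
      refine ((integrableOn_mul_tentSign hv b).add (integrableOn_mul_of_continuous hv
        (continuous_const.mul (hψ.continuous_deriv le_rfl)) (f := fun s => ε * deriv ψ s))).congr
        (Eventually.of_forall fun s => ?_)
      simp only [Pi.add_apply]
      ring
    have hI' : IntegrableOn (fun s => (v s * tentSign b s + √(1 - tent b s ^ 2))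
        + ε * (v s * deriv ψ s + tentSlope b s * ψ s)) (Ioo (-1:ℝ) 1) :=
      (integrableOn_tentPairing hv b).add (hLint.const_mul ε)
    have hlow : tentPairing b v + ε * L - 2 * D * ε ^ 2 ≤
        ∫ s in Ioo (-1:ℝ) 1, (v s * (tentSign b s + ε * deriv ψ s)
          + √(1 - (-tent b s + ε * ψ s) ^ 2)) := by
      calc tentPairing b v + ε * L - 2 * D * ε ^ 2
          = ∫ s in Ioo (-1:ℝ) 1, ((v s * tentSign b s + √(1 - tent b s ^ 2))
              + ε * (v s * deriv ψ s + tentSlope b s * ψ s) - D * ε ^ 2) := by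
            rw [integral_sub hI' (integrable_const _),
              integral_add (integrableOn_tentPairing hv b) (hLint.const_mul ε),
              integral_const_mul, setIntegral_const, hvol, tentPairing, smul_eq_mul]
            ring
        _ ≤ _ := by
            refine integral_mono (hI'.sub (integrable_const _)) hI fun s => ?_
            have hexp := le_sqrt_one_sub_sq hm0 (tent_nonneg b s) (t := ε * ψ s)
              (by nlinarith [tent_nonneg b s, tent_le hb0 s]) ((hεψ s).trans hε.le)
            have hquad : 3 / m ^ 3 * (ε * ψ s) ^ 2 ≤ D * ε ^ 2 := by
              have h2 := pow_le_pow_left₀ (abs_nonneg _) (hεψ s) 2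
              rw [sq_abs, mul_pow |ε|, sq_abs] at h2
              calc 3 / m ^ 3 * (ε * ψ s) ^ 2 ≤ 3 / m ^ 3 * (ε ^ 2 * M ^ 2) := by gcongr
                _ = D * ε ^ 2 := by rw [hD]; ring
            simp only [tentSlope]
            nlinarith
    simp only [zero_mul, ne_eq, OfNat.ofNat_ne_zero, not_false_eq_true, zero_pow, mul_zero,
      sub_zero]
    linarith
  refine hlocal.hasDerivAt_eq_zero ?_
  have hderiv := ((hasDerivAt_id (0:ℝ)).mul_const L).sub
    ((hasDerivAt_pow 2 (0:ℝ)).const_mul (2 * D))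
  exact hderiv.congr_deriv (by simp)

end Calibration

lemma integrableOn_of_eq_jump {a : ℝ} {g : ℝ → ℝ} (hg1 : ∀ s ∈ Ioo (0:ℝ) 1, g s = a)
    (hg2 : ∀ s ∈ Ioo (-1:ℝ) 0, g s = -a) : IntegrableOn g (Ioo (-1:ℝ) 1) := by
  have h1 : IntegrableOn g (Ioo (-1:ℝ) 0) :=
    (integrableOn_const (C := -a) (by simp)).congr_fun (fun s hs => (hg2 s hs).symm)
      measurableSet_Ioo
  have h2 : IntegrableOn g (Ico (0:ℝ) 1) := by
    rw [integrableOn_Ico_iff_integrableOn_Ioo]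
    exact (integrableOn_const (C := a) (by simp)).congr_fun (fun s hs => (hg1 s hs).symm)
      measurableSet_Ioo
  rw [← Ioo_union_Ico_eq_Ioo (by norm_num : (-1:ℝ) < 0) zero_le_one]
  exact h1.union h2

lemma Gfun_one_eq {φ : E2 → ℝ} {g v : ℝ → ℝ} {I : Set ℝ} (hv : IntegrableOn v I)
    (hg : IntegrableOn g I) :
    Gfun φ 1 g I v = aniArea φ v I + ENNReal.ofReal (∫ s in I, |v s - g s|) := by
  have h : IntegrableOn (fun s => |v s - g s|) I := (hv.sub hg).abs
  rw [Gfun, ofReal_integral_eq_lintegral_ofReal h (Eventually.of_forall fun s => abs_nonneg _)]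
  simp only [Real.rpow_one]

lemma integrableOn_excess {v g : ℝ → ℝ} (hv : IntegrableOn v (Ioo (-1:ℝ) 1))
    (hg : IntegrableOn g (Ioo (-1:ℝ) 1)) (b : ℝ) :
    IntegrableOn (fun s => |v s - g s| + (v s - g s) * tentSign b s) (Ioo (-1:ℝ) 1) :=
  (hv.sub hg).abs.add (integrableOn_mul_tentSign (hv.sub hg) b)

lemma excess_nonneg (x b s : ℝ) : 0 ≤ |x| + x * tentSign b s := by
  have h : |x * tentSign b s| ≤ |x| := by
    rw [abs_mul]
    exact mul_le_of_le_one_right (abs_nonneg x) (abs_tentSign_le b s)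
  linarith [neg_abs_le (x * tentSign b s)]

lemma tentPairing_add_integral_abs {v g : ℝ → ℝ} (hv : IntegrableOn v (Ioo (-1:ℝ) 1))
    (hg : IntegrableOn g (Ioo (-1:ℝ) 1)) (b : ℝ) :
    tentPairing b v + ∫ s in Ioo (-1:ℝ) 1, |v s - g s| = tentPairing b g +
      ∫ s in Ioo (-1:ℝ) 1, (|v s - g s| + (v s - g s) * tentSign b s) := by
  have h : IntegrableOn (fun s => |v s - g s|) (Ioo (-1:ℝ) 1) := (hv.sub hg).abs
  rw [tentPairing, tentPairing, ← integral_add (integrableOn_tentPairing hv b) h,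
    ← integral_add (integrableOn_tentPairing hg b) (integrableOn_excess hv hg b)]
  congr 1 with s
  ring

section Arcs

variable {a b : ℝ} {g u : ℝ → ℝ}

lemma one_sub_le_sqrt_one_sub_tent_sq (hb0 : 0 ≤ b) (hab : b ^ 2 = 2 * a - a ^ 2)
    (s : ℝ) : 1 - a ≤ √(1 - tent b s ^ 2) := by
  refine Real.le_sqrt_of_sq_le ?_
  nlinarith [tent_nonneg b s, tent_le hb0 s]

lemma sqrt_one_sub_tent_sq_le_one (b s : ℝ) : √(1 - tent b s ^ 2) ≤ 1 := by
  rw [Real.sqrt_le_one]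
  linarith [sq_nonneg (tent b s)]

lemma excess_arcs_eq_zero
    (hg1 : ∀ s ∈ Ioo (0:ℝ) 1, g s = a) (hg2 : ∀ s ∈ Ioo (-1:ℝ) 0, g s = -a)
    (hpos : ∀ s ∈ Ico (0:ℝ) 1, u s = a - 1 + √(1 - tent b s ^ 2))
    (hneg : ∀ s ∈ Ioc (-1:ℝ) 0, u s = 1 - a - √(1 - tent b s ^ 2))
    {s : ℝ} (hs : s ∈ Ioo (-1:ℝ) 1) (hs0 : s ≠ 0) :
    |u s - g s| + (u s - g s) * tentSign b s = 0 := by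
  have hle := sqrt_one_sub_tent_sq_le_one b s
  rcases lt_or_gt_of_ne hs0 with h | h
  · rw [hg2 s ⟨hs.1, h⟩, hneg s ⟨hs.1, h.le⟩, abs_of_nonneg (by linarith), tentSign]
    split_ifs with h1 h2
    · exact absurd h2 h.not_gt
    · ring
    · rw [tent_of_le (not_lt.1 h1)]
      simp
  · rw [hg1 s ⟨h, hs.2⟩, hpos s ⟨h.le, hs.2⟩, abs_of_nonpos (by linarith), tentSign]
    split_ifs with h1
    · ring
    · rw [tent_of_le (not_lt.1 h1)]
      simp

lemma integrableOn_arcs (ha : a ∈ Ioo (0:ℝ) 1) (hb1 : b < 1)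
    (hpos : ∀ s ∈ Ico (0:ℝ) 1, u s = a - 1 + √(1 - tent b s ^ 2))
    (hneg : ∀ s ∈ Ioc (-1:ℝ) 0, u s = 1 - a - √(1 - tent b s ^ 2)) :
    IntegrableOn u (Ioo (-1:ℝ) 1) := by
  have hcont : ContinuousOn u (Ioo (-1:ℝ) 1) := fun s hs =>
    (hasDerivAt_arcs hb1 hpos hneg hs).continuousAt.continuousWithinAt
  refine (integrable_const (1:ℝ)).mono' (hcont.aestronglyMeasurable measurableSet_Ioo) ?_
  filter_upwards [ae_restrict_mem measurableSet_Ioo] with s hs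
  have h1 := sqrt_one_sub_tent_sq_le_one b s
  have h0 := Real.sqrt_nonneg (1 - tent b s ^ 2)
  rw [Real.norm_eq_abs, abs_le]
  rcases le_total s 0 with h | h
  · rw [hneg s ⟨hs.1, h⟩]
    constructor <;> linarith [ha.1, ha.2]
  · rw [hpos s ⟨h, hs.2⟩]
    constructor <;> linarith [ha.1, ha.2]

/-- Two functions on `(-1, 1)` with the same distributional derivative `tentSlope b` which agree
outside `[-b, b]` are equal. -/
lemma ae_eq_of_integral_mul_deriv_add_tentSlope_mul {v : ℝ → ℝ} (hb0 : 0 < b) (hb1 : b < 1)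
    (hu : IntegrableOn u (Ioo (-1:ℝ) 1))
    (hu' : ∀ s ∈ Ioo (-1:ℝ) 1, HasDerivAt u (tentSlope b s) s)
    (hv : IntegrableOn v (Ioo (-1:ℝ) 1))
    (hv' : ∀ ψ : ℝ → ℝ, ContDiff ℝ 1 ψ → ∀ r < 1, (∀ s, r ≤ |s| → ψ s = 0) →
      ∫ s in Ioo (-1:ℝ) 1, (v s * deriv ψ s + tentSlope b s * ψ s) = 0)
    (hvu : ∀ᵐ s ∂volume.restrict (Ioo (-1:ℝ) 1), b < |s| → v s - u s = 0) :
    v =ᵐ[volume.restrict (Ioo (-1:ℝ) 1)] u := by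
  have h := ae_eq_zero_of_integral_mul_deriv_eq_zero hb0 hb1 (w := fun s => v s - u s)
    (hv.sub hu) hvu fun ψ hψ r hr hψr => by
      have hint : ∀ {w : ℝ → ℝ}, IntegrableOn w (Ioo (-1:ℝ) 1) →
          IntegrableOn (fun s => w s * deriv ψ s + tentSlope b s * ψ s) (Ioo (-1:ℝ) 1) :=
        fun hw => (integrableOn_mul_of_continuous hw (hψ.continuous_deriv le_rfl)).add
          (integrableOn_of_continuous ((continuous_tentSlope hb0.le hb1).mul hψ.continuous))
      have hU := integral_mul_add_mul_eq_zero hr hu' hψ.continuous hψr countable_empty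
        (fun s _ => (hψ.differentiable one_ne_zero s).hasDerivAt) (hint hu)
      calc ∫ s in Ioo (-1:ℝ) 1, (v s - u s) * deriv ψ s
          = ∫ s in Ioo (-1:ℝ) 1, ((v s * deriv ψ s + tentSlope b s * ψ s)
              - (u s * deriv ψ s + tentSlope b s * ψ s)) := by
            congr 1 with s
            ring
        _ = 0 := by rw [integral_sub (hint hv) (hint hu), hv' ψ hψ r hr hψr, hU, sub_zero]
  filter_upwards [h] with s hs
  exact sub_eq_zero.1 hs

end Arcs

/-- an explicit `C^{1,1} ∖ C²` unique minimizer in the Euclidean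
case with jump datum `g = ±a`. -/
theorem stmt19
    (a : ℝ) (ha : a ∈ Set.Ioo (0:ℝ) 1) (b : ℝ) (hb : b = Real.sqrt (2 * a - a ^ 2))
    (g u : ℝ → ℝ)
    (hg1 : ∀ s ∈ Set.Ioo (0:ℝ) 1, g s = a)
    (hg2 : ∀ s ∈ Set.Ioo (-1:ℝ) 0, g s = -a)
    (hu1 : ∀ s ∈ Set.Ico b 1, u s = a)
    (hu2 : ∀ s ∈ Set.Icc (0:ℝ) b, u s = a - 1 + Real.sqrt (1 - (s - b) ^ 2))
    (hu3 : ∀ s ∈ Set.Icc (-b) (0:ℝ), u s = 1 - a - Real.sqrt (1 - (s + b) ^ 2))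
    (hu4 : ∀ s ∈ Set.Ioc (-1:ℝ) (-b), u s = -a) :
    (∃ u' : ℝ → ℝ, (∀ s ∈ Set.Ioo (-1:ℝ) 1, HasDerivAt u (u' s) s) ∧
      ∃ K : ℝ≥0, LipschitzOnWith K u' (Set.Ioo (-1:ℝ) 1)) ∧
    ¬ ContDiffOn ℝ 2 u (Set.Ioo (-1:ℝ) 1) ∧
    (∀ v : ℝ → ℝ, BVOn v (Set.Ioo (-1:ℝ) 1) →
      Gfun (fun x : E2 => ‖x‖) 1 g (Set.Ioo (-1:ℝ) 1) u ≤
        Gfun (fun x : E2 => ‖x‖) 1 g (Set.Ioo (-1:ℝ) 1) v) ∧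
    (∀ v : ℝ → ℝ, BVOn v (Set.Ioo (-1:ℝ) 1) →
      Gfun (fun x : E2 => ‖x‖) 1 g (Set.Ioo (-1:ℝ) 1) v =
        Gfun (fun x : E2 => ‖x‖) 1 g (Set.Ioo (-1:ℝ) 1) u →
      v =ᵐ[volume.restrict (Set.Ioo (-1:ℝ) 1)] u) := by
  obtain ⟨ha0, ha1⟩ := ha
  have hab : b ^ 2 = 2 * a - a ^ 2 := by rw [hb, Real.sq_sqrt (by nlinarith)]
  have hb0 : 0 < b := by
    rw [hb]
    exact Real.sqrt_pos.2 (by nlinarith)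
  have hb1 : b < 1 := by nlinarith [sq_pos_of_pos (sub_pos.2 ha1)]
  have hpos : ∀ s ∈ Ico (0:ℝ) 1, u s = a - 1 + √(1 - tent b s ^ 2) := by
    intro s hs
    rcases le_total b s with h | h
    · rw [hu1 s ⟨h, hs.2⟩, tent_of_le (h.trans (le_abs_self s))]
      simp
    · rw [hu2 s ⟨hs.1, h⟩, tent_of_ge (by rwa [abs_of_nonneg hs.1]), abs_of_nonneg hs.1,
        ← neg_sub b s, neg_sq]
  have hneg : ∀ s ∈ Ioc (-1:ℝ) 0, u s = 1 - a - √(1 - tent b s ^ 2) := by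
    intro s hs
    rcases le_total s (-b) with h | h
    · rw [hu4 s ⟨hs.1, h⟩, tent_of_le (by rw [abs_of_nonpos hs.2]; linarith)]
      simp
    · rw [hu3 s ⟨h, hs.2⟩, tent_of_ge (by rw [abs_of_nonpos hs.2]; linarith),
        abs_of_nonpos hs.2, sub_neg_eq_add, add_comm b s]
  have hderiv : ∀ s ∈ Ioo (-1:ℝ) 1, HasDerivAt u (tentSlope b s) s := fun s hs =>
    hasDerivAt_arcs hb1 hpos hneg hs
  have hgint := integrableOn_of_eq_jump hg1 hg2
  have huint := integrableOn_arcs ⟨ha0, ha1⟩ hb1 hpos hneg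
  have hne0 : ∀ᵐ s ∂volume.restrict (Ioo (-1:ℝ) 1), s ≠ 0 :=
    ae_restrict_of_ae (Measure.ae_ne volume 0)
  have hexu : ∫ s in Ioo (-1:ℝ) 1, (|u s - g s| + (u s - g s) * tentSign b s) = 0 := by
    refine integral_eq_zero_of_ae ?_
    filter_upwards [hne0, ae_restrict_mem measurableSet_Ioo] with s hs0 hs
    exact excess_arcs_eq_zero hg1 hg2 hpos hneg hs hs0
  have habs : ∀ w : ℝ → ℝ, 0 ≤ ∫ s in Ioo (-1:ℝ) 1, |w s - g s| := fun w =>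
    integral_nonneg fun s => abs_nonneg _
  have hidu := tentPairing_add_integral_abs huint hgint b
  rw [hexu, add_zero] at hidu
  have hBu : 0 ≤ tentPairing b u := by
    refine setIntegral_nonneg measurableSet_Ioo fun s hs => ?_
    have hlow := one_sub_le_sqrt_one_sub_tent_sq hb0.le hab s
    rw [tentSign]
    split_ifs with h1 h2
    · rw [hpos s ⟨h2.le, hs.2⟩]
      linarith
    · rw [hneg s ⟨hs.1, not_lt.1 h2⟩]
      linarith
    · linarith
  have hlower : ∀ v : ℝ → ℝ, IntegrableOn v (Ioo (-1:ℝ) 1) →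
      ENNReal.ofReal (tentPairing b v + ∫ s in Ioo (-1:ℝ) 1, |v s - g s|) ≤
        Gfun (fun x : E2 => ‖x‖) 1 g (Ioo (-1:ℝ) 1) v := fun v hv => by
    rw [Gfun_one_eq hv hgint]
    exact ENNReal.ofReal_add_le.trans
      (add_le_add_left (ofReal_tentPairing_le_aniArea hb0.le hb1 hv) _)
  have hupper : Gfun (fun x : E2 => ‖x‖) 1 g (Ioo (-1:ℝ) 1) u ≤
      ENNReal.ofReal (tentPairing b g) := by
    rw [Gfun_one_eq huint hgint, ← hidu, ENNReal.ofReal_add _ (habs u)]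
    · exact add_le_add_left (aniArea_le_ofReal_tentPairing hb0.le hb1 huint hderiv) _
    · exact hBu
  refine ⟨⟨tentSlope b, hderiv, ?_⟩, not_contDiffOn_two_of_hasDerivAt_tentSlope hb0 hb1 hderiv,
    fun v hv => ?_, fun v hv heq => ?_⟩
  · obtain ⟨K, hK⟩ := exists_lipschitzWith_tentSlope hb0.le hb1
    exact ⟨K, hK.lipschitzOnWith⟩
  · refine hupper.trans (le_trans (ENNReal.ofReal_le_ofReal ?_) (hlower v hv.1))
    rw [tentPairing_add_integral_abs hv.1 hgint b]
    exact le_add_of_nonneg_right (integral_nonneg fun s => excess_nonneg _ _ _)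
  · have hGle := heq.le.trans hupper
    have hidv := tentPairing_add_integral_abs hv.1 hgint b
    have hexv0 : 0 ≤ ∫ s in Ioo (-1:ℝ) 1, (|v s - g s| + (v s - g s) * tentSign b s) :=
      integral_nonneg fun s => excess_nonneg _ _ _
    have hexv : ∫ s in Ioo (-1:ℝ) 1, (|v s - g s| + (v s - g s) * tentSign b s) = 0 := by
      have h := (hlower v hv.1).trans hGle
      rw [ENNReal.ofReal_le_ofReal_iff (hidu ▸ add_nonneg hBu (habs u))] at h
      linarith
    have harea : aniArea (fun x : E2 => ‖x‖) v (Ioo (-1:ℝ) 1) ≤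
        ENNReal.ofReal (tentPairing b v) := by
      rw [hexv, add_zero] at hidv
      rw [Gfun_one_eq hv.1 hgint, ← hidv] at hGle
      exact (ENNReal.add_le_add_iff_right ENNReal.ofReal_ne_top).1
        (hGle.trans ENNReal.ofReal_add_le)
    refine ae_eq_of_integral_mul_deriv_add_tentSlope_mul hb0 hb1 huint hderiv hv.1
      (fun ψ hψ r hr hψr => integral_mul_deriv_add_tentSlope_mul_eq_zero hb0.le hb1 hv.1 harea hψ
        hr hψr) ?_
    rw [integral_eq_zero_iff_of_nonneg (fun s => excess_nonneg _ _ _)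
      (integrableOn_excess hv.1 hgint b)] at hexv
    filter_upwards [hexv, hne0, ae_restrict_mem measurableSet_Ioo] with s hs hs0 hsI hbs
    have hzero : tentSign b s = 0 := if_neg hbs.not_gt
    have hsu := excess_arcs_eq_zero hg1 hg2 hpos hneg hsI hs0
    simp only [hzero, mul_zero, add_zero, Pi.zero_apply, abs_eq_zero] at hs hsu
    linarith

end
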